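/- Let a, b be real with a > 0, b > 0 and a⁵ > 49·b⁵. If (x, y, z, w) is a singular point of the affine quintic, then x·w = 0 and y·z = 0. -/

import Mathlib

/-- The auxiliary cubic `φ_c(u,v,t) = (u+v)^3 + 3uv(u+v) + c t^3`. -/
noncomputable def phi (c u v t : ℂ) : ℂ := (u + v) ^ 3 + 3 * u * v * (u + v) + c * t ^ 3

/-- The quintic `F = xw φ_a(x,w,t) - yz φ_b(y,z,t)`. -/
noncomputable def F (a b : ℝ) (x y z w t : ℂ) : ℂ :=
  x * w * phi (a : ℂ) x w t - y * z * phi (b : ℂ) y z t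

/-- `(x,y,z,w)` is a singular point of the affine quintic `F(·,·,·,·,1) = 0`. -/
def IsSingularPoint (a b : ℝ) (x y z w : ℂ) : Prop :=
  F a b x y z w 1 = 0 ∧
  deriv (fun s => F a b s y z w 1) x = 0 ∧
  deriv (fun s => F a b x s z w 1) y = 0 ∧
  deriv (fun s => F a b x y s w 1) z = 0 ∧
  deriv (fun s => F a b x y z s 1) w = 0

lemma phi_comm (c u v t : ℂ) : phi c u v t = phi c v u t := by
  unfold phi; ring

lemma hasDerivAt_mul_phi (c u v : ℂ) :
    HasDerivAt (fun s => s * v * phi c s v 1)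
      (v * (phi c u v 1 + u * (3 * (u + v) ^ 2 + 6 * u * v + 3 * v ^ 2))) u := by
  have h₁ : HasDerivAt (fun s : ℂ => s * v) v u := by
    simpa using (hasDerivAt_id u).mul_const v
  have h₂ : HasDerivAt (fun s : ℂ => s + v) 1 u := (hasDerivAt_id u).add_const v
  have h₃ : HasDerivAt (fun s => phi c s v 1)
      (3 * (u + v) ^ 2 + 3 * (v * (u + v) + u * v)) u := by
    have h := ((h₂.pow 3).add ((h₁.mul h₂).const_mul 3)).add_const c
    refine (h.congr_of_eventuallyEq (.of_forall fun s => ?_)).congr_deriv ?_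
    · simp only [phi, Pi.add_apply, Pi.mul_apply, Pi.pow_apply]
      ring
    · push_cast
      ring
  exact (h₁.mul h₃).congr_deriv (by ring)

/-- The cube of a critical value of `uv φ_c(u,v,1)` at a point with `uv ≠ 0` takes one of two
explicit values. -/
lemma critical_value_cube (c u v : ℂ)
    (hu : v * (phi c u v 1 + u * (3 * (u + v) ^ 2 + 6 * u * v + 3 * v ^ 2)) = 0)
    (hv : u * (phi c v u 1 + v * (3 * (v + u) ^ 2 + 6 * v * u + 3 * u ^ 2)) = 0)
    (huv : u * v ≠ 0) :
    3125 * (u * v * phi c u v 1) ^ 3 = -27 * c ^ 5 ∨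
      49 * (3125 * (u * v * phi c u v 1) ^ 3) = 27 * c ^ 5 := by
  obtain ⟨hu₀, hv₀⟩ := mul_ne_zero_iff.mp huv
  have h₁ := (mul_eq_zero.mp hu).resolve_left hv₀
  have h₂ := (mul_eq_zero.mp hv).resolve_left hu₀
  unfold phi at *
  have h₃ : (u - v) * ((u + v) ^ 2 + u * v) = 0 := by
    linear_combination (h₁ - h₂) / 3
  rcases mul_eq_zero.mp h₃ with h | h
  · obtain rfl : u = v := sub_eq_zero.mp h
    have hc : c = -35 * u ^ 3 := by linear_combination h₁
    right
    rw [hc]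
    ring
  · have hp : u * v = -(u + v) ^ 2 := by linear_combination h
    have hc : c = 5 * (u + v) ^ 3 := by
      linear_combination (h₁ + h₂) / 2 - 15 / 2 * (u + v) * hp
    left
    have hG : u * v * ((u + v) ^ 3 + 3 * u * v * (u + v) + c * 1 ^ 3) = -3 * (u + v) ^ 5 := by
      rw [mul_assoc 3 u v, hp, hc]
      ring
    rw [hG, hc]
    ring

/-- If `a, b > 0` and `a⁵ > 49 b⁵`, any singular point of the affine quintic
satisfies `xw = 0` and `yz = 0`. -/
theorem singular_point_xw_yz_eq_zero (a b : ℝ) (ha : 0 < a) (hb : 0 < b)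
    (hab : a ^ 5 > 49 * b ^ 5) (x y z w : ℂ)
    (h : IsSingularPoint a b x y z w) :
    x * w = 0 ∧ y * z = 0 := by
  obtain ⟨hF, hx, hy, hz, hw⟩ := h
  have hFab : x * w * phi a x w 1 = y * z * phi b y z 1 := sub_eq_zero.mp hF
  have hw_fun : (fun s => F a b x y z s 1) =
      fun s => s * x * phi a s x 1 - y * z * phi b y z 1 := by
    funext s
    rw [F, phi_comm _ x s, mul_comm x s]
  have hz_fun : (fun s => F a b x y s w 1) =
      fun s => x * w * phi a x w 1 - s * y * phi b s y 1 := by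
    funext s
    rw [F, phi_comm _ y s, mul_comm y s]
  rw [hw_fun] at hw
  rw [hz_fun] at hz
  have hx' := ((hasDerivAt_mul_phi a x w).sub_const (y * z * phi b y z 1)).deriv.symm.trans hx
  have hw' := ((hasDerivAt_mul_phi a w x).sub_const (y * z * phi b y z 1)).deriv.symm.trans hw
  have hy' := neg_eq_zero.mp
    (((hasDerivAt_mul_phi b y z).const_sub (x * w * phi a x w 1)).deriv.symm.trans hy)
  have hz' := neg_eq_zero.mp
    (((hasDerivAt_mul_phi b z y).const_sub (x * w * phi a x w 1)).deriv.symm.trans hz)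
  have hA := critical_value_cube a x w hx' hw'
  have hB := critical_value_cube b y z hy' hz'
  have ha5 : 0 < a ^ 5 := by positivity
  have hb5 : 0 < b ^ 5 := by positivity
  by_cases hxw : x * w = 0
  · refine ⟨hxw, ?_⟩
    by_contra hyz
    have hzero : y * z * phi b y z 1 = 0 := by rw [← hFab, hxw, zero_mul]
    have hb0 : (b : ℂ) ≠ 0 := by exact_mod_cast hb.ne'
    simpa [hzero, hb0] using hB hyz
  · exfalso
    by_cases hyz : y * z = 0
    · have hzero : x * w * phi a x w 1 = 0 := by rw [hFab, hyz, zero_mul]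
      have ha0 : (a : ℂ) ≠ 0 := by exact_mod_cast ha.ne'
      simpa [hzero, ha0] using hA hxw
    · rw [hFab] at hA
      rcases hA hxw with h₁ | h₁ <;> rcases hB hyz with h₂ | h₂
      · have h : (a : ℂ) ^ 5 = b ^ 5 := by linear_combination (h₁ - h₂) / 27
        norm_cast at h
        linarith
      · have h : 49 * (a : ℂ) ^ 5 + b ^ 5 = 0 := by linear_combination (49 * h₁ - h₂) / 27
        norm_cast at h
        linarith
      · have h : (a : ℂ) ^ 5 + 49 * b ^ 5 = 0 := by linear_combination (49 * h₂ - h₁) / 27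
        norm_cast at h
        linarith
      · have h : (a : ℂ) ^ 5 = b ^ 5 := by linear_combination (h₂ - h₁) / 27
        norm_cast at h
        linarith
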